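/- There exists a constant C₂ > 0 such that for every r > 1, every s > 0 and every f ∈ C_b^∞(ℝ^d), the local super Poincaré inequality holds: ∫_{B(0,r)} f(x)² μ_V(dx) ≤ s · 𝓔_{α,V}(f,f) + β_r(s) ( ∫_{B(0,r+1)} |f(x)| μ_V(dx) )², where β_r(s) = C₂ · r^{d + d²/α} K(r)^{1 + d/α} k(r)^{−(2 + d/α)} (1 + s^{−d/α}). -/

import Mathlib

open MeasureTheory Real Set Metric Filter

noncomputable section

/-- Euclidean space `ℝ^d`. -/
abbrev Ed (d : ℕ) := EuclideanSpace ℝ (Fin d)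

/-- The probability measure `μ_V(dx) = C_V e^{-V(x)} dx` with `C_V = (∫ e^{-V})⁻¹`. -/
def muV (d : ℕ) (V : Ed d → ℝ) : Measure (Ed d) :=
  (volume : Measure (Ed d)).withDensity
    fun x => ENNReal.ofReal ((∫ y, Real.exp (-V y))⁻¹ * Real.exp (-V x))

/-- `f ∈ C_b^∞(ℝ^d)`: smooth with bounded derivatives of every order. -/
def CbSmooth (d : ℕ) (f : Ed d → ℝ) : Prop :=
  ContDiff ℝ (⊤ : ℕ∞) f ∧ ∀ n : ℕ, ∃ C : ℝ, ∀ x, ‖iteratedFDeriv ℝ n f x‖ ≤ C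

/-- `V` is locally bounded. -/
def LocallyBounded (d : ℕ) (V : Ed d → ℝ) : Prop :=
  ∀ r : ℝ, ∃ M : ℝ, ∀ x : Ed d, ‖x‖ ≤ r → |V x| ≤ M

/-- The nonlocal Dirichlet form with finite range jumps `𝓔_{α,V}`. -/
def formE (d : ℕ) (α : ℝ) (V f : Ed d → ℝ) : ℝ :=
  (1/2) * ∫ x, (∫ y in {y : Ed d | dist x y ≤ 1},
      (f x - f y) ^ 2 / dist x y ^ ((d : ℝ) + α)) ∂(muV d V)

/-- The nonlocal Dirichlet form with large jumps `𝓓_{α,V}`. -/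
def formD (d : ℕ) (α : ℝ) (V f : Ed d → ℝ) : ℝ :=
  (1/2) * ∫ x, (∫ y in {y : Ed d | 1 < dist x y},
      (f x - f y) ^ 2 / dist x y ^ ((d : ℝ) + α)) ∂(muV d V)

/-- `inf_{z : |x|-1 ≤ |z| ≤ |x|-1/2} e^{-V(z)}`. -/
def infAnn (d : ℕ) (V : Ed d → ℝ) (x : Ed d) : ℝ :=
  sInf ((fun z => Real.exp (-V z)) '' {z : Ed d | ‖x‖ - 1 ≤ ‖z‖ ∧ ‖z‖ ≤ ‖x‖ - 1/2})

/-- `sup_{z : |x| ≤ |z| ≤ |x|+1} e^{-V(z)}`. -/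
def supAnn (d : ℕ) (V : Ed d → ℝ) (x : Ed d) : ℝ :=
  sSup ((fun z => Real.exp (-V z)) '' {z : Ed d | ‖x‖ ≤ ‖z‖ ∧ ‖z‖ ≤ ‖x‖ + 1})

/-- `K(r) = sup_{|x| ≤ r} e^{-V(x)}`. -/
def Kfun (d : ℕ) (V : Ed d → ℝ) (r : ℝ) : ℝ :=
  sSup ((fun x => Real.exp (-V x)) '' {x : Ed d | ‖x‖ ≤ r})

/-- `k(r) = inf_{|x| ≤ r+1} e^{-V(x)}`. -/
def kfun (d : ℕ) (V : Ed d → ℝ) (r : ℝ) : ℝ :=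
  sInf ((fun x => Real.exp (-V x)) '' {x : Ed d | ‖x‖ ≤ r + 1})

/-- The constant `(1/α)·2^{2d+1}·(e + e^{1/2})·(2^α − 1)`. -/
def thresholdConst (d : ℕ) (α : ℝ) : ℝ :=
  (1/α) * (2:ℝ) ^ (2*d+1) * (Real.exp 1 + Real.exp (1/2)) * ((2:ℝ) ^ α - 1)

/-- The squared increments of `f`, weighted by the jump kernel of range one. -/
def jumpEnergy (d : ℕ) (α : ℝ) (f : Ed d → ℝ) (x : Ed d) : ℝ :=
  ∫ z in closedBall (0 : Ed d) 1, (f x - f (x + z)) ^ 2 / ‖z‖ ^ ((d : ℝ) + α)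

theorem setIntegral_comp_add_left {d : ℕ} (g : Ed d → ℝ) (x : Ed d) (S : Set (Ed d)) :
    ∫ z in (fun z => x + z) ⁻¹' S, g (x + z) = ∫ y in S, g y :=
  (measurePreserving_add_left (volume : Measure (Ed d)) x).setIntegral_preimage_emb
    (measurableEmbedding_addLeft x) g S

theorem formE_eq_jumpEnergy (d : ℕ) (α : ℝ) (V f : Ed d → ℝ) :
    formE d α V f = (1/2) * ∫ x, jumpEnergy d α f x ∂(muV d V) := by
  unfold formE jumpEnergy
  congr 2
  ext x
  rw [← setIntegral_comp_add_left _ x]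
  have : (fun z => x + z) ⁻¹' {y : Ed d | dist x y ≤ 1} = closedBall (0 : Ed d) 1 := by
    ext z; simp [dist_eq_norm]
  rw [this]
  simp [dist_eq_norm]

theorem integrableOn_closedBall_norm_rpow {d : ℕ} (hd : 1 ≤ d) {α : ℝ} (hα : α < 2) :
    IntegrableOn (fun z : Ed d => ‖z‖ ^ (2 - ((d : ℝ) + α))) (closedBall 0 1) := by
  have : Nontrivial (Ed d) := by
    have : Nonempty (Fin d) := ⟨⟨0, hd⟩⟩
    infer_instance
  rw [← integrable_indicator_iff measurableSet_closedBall]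
  have h : (closedBall (0 : Ed d) 1).indicator (fun z : Ed d => ‖z‖ ^ (2 - ((d : ℝ) + α))) =
      fun z => (Iic (1 : ℝ)).indicator (fun t => t ^ (2 - ((d : ℝ) + α))) ‖z‖ := by
    ext z; by_cases hz : ‖z‖ ≤ 1 <;> simp [indicator, hz]
  rw [h, integrable_fun_norm_addHaar (volume : Measure (Ed d))
    (f := (Iic (1 : ℝ)).indicator (fun t => t ^ (2 - ((d : ℝ) + α))))]
  have h2 : IntegrableOn (fun t : ℝ => t ^ (1 - α)) (Ioc 0 1) := by
    have := intervalIntegral.intervalIntegrable_rpow' (a := 0) (b := 1) (r := 1 - α) (by linarith)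
    rwa [intervalIntegrable_iff_integrableOn_Ioc_of_le zero_le_one] at this
  rw [← integrable_indicator_iff measurableSet_Ioc] at h2
  rw [← integrable_indicator_iff measurableSet_Ioi]
  refine h2.congr (Eventually.of_forall fun t => ?_)
  by_cases h0 : 0 < t
  · by_cases h1 : t ≤ 1
    · simp only [indicator, mem_Ioc, mem_Ioi, mem_Iic, h0, h1, and_self, if_true, smul_eq_mul,
        finrank_euclideanSpace, Fintype.card_fin]
      rw [← Real.rpow_natCast, ← Real.rpow_add h0, Nat.cast_sub hd]
      congr 1; push_cast; ring
    · simp [indicator, h1]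
  · simp [indicator, h0]

theorem jumpIntegrand_le {d : ℕ} {α L : ℝ} {f : Ed d → ℝ}
    (hL : ∀ x y, |f x - f y| ≤ L * ‖x - y‖) (x z : Ed d) :
    (f x - f (x + z)) ^ 2 / ‖z‖ ^ ((d : ℝ) + α) ≤ L ^ 2 * ‖z‖ ^ (2 - ((d : ℝ) + α)) := by
  rcases eq_or_ne z 0 with rfl | hz
  · simp; positivity
  have hz' : 0 < ‖z‖ := norm_pos_iff.2 hz
  rw [Real.rpow_sub hz', ← mul_div_assoc]
  gcongr
  have h := hL x (x + z)
  rw [← sq_abs]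
  calc |f x - f (x + z)| ^ 2 ≤ (L * ‖z‖) ^ 2 := by
        gcongr; simpa using h
    _ = L ^ 2 * ‖z‖ ^ (2 : ℝ) := by rw [mul_pow]; norm_cast

theorem jumpIntegrand_nonneg {d : ℕ} {α : ℝ} (f : Ed d → ℝ) (x z : Ed d) :
    0 ≤ (f x - f (x + z)) ^ 2 / ‖z‖ ^ ((d : ℝ) + α) := by positivity

theorem integrableOn_jumpIntegrand {d : ℕ} (hd : 1 ≤ d) {α L : ℝ} (hα : α < 2) {f : Ed d → ℝ}
    (hf : Continuous f) (hL : ∀ x y, |f x - f y| ≤ L * ‖x - y‖) (x : Ed d) :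
    IntegrableOn (fun z => (f x - f (x + z)) ^ 2 / ‖z‖ ^ ((d : ℝ) + α)) (closedBall 0 1) := by
  refine ((integrableOn_closedBall_norm_rpow hd hα).const_mul (L ^ 2)).mono' ?_ ?_
  · refine Measurable.aestronglyMeasurable ?_
    have := hf.measurable
    fun_prop
  · refine Eventually.of_forall fun z => ?_
    rw [Real.norm_of_nonneg (jumpIntegrand_nonneg f x z)]
    exact jumpIntegrand_le hL x z

theorem jumpEnergy_nonneg {d : ℕ} {α : ℝ} (f : Ed d → ℝ) (x : Ed d) :
    0 ≤ jumpEnergy d α f x :=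
  integral_nonneg fun z => jumpIntegrand_nonneg f x z

theorem integrable_jumpEnergy {d : ℕ} (hd : 1 ≤ d) {α L : ℝ} (hα : α < 2) {f : Ed d → ℝ}
    (hf : Continuous f) (hL : ∀ x y, |f x - f y| ≤ L * ‖x - y‖)
    (μ : Measure (Ed d)) [IsFiniteMeasure μ] : Integrable (jumpEnergy d α f) μ := by
  refine Integrable.of_bound ?_
    (∫ z in closedBall (0 : Ed d) 1, L ^ 2 * ‖z‖ ^ (2 - ((d : ℝ) + α))) ?_
  · refine StronglyMeasurable.aestronglyMeasurable ?_
    refine StronglyMeasurable.integral_prod_right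
      (f := fun x z => (f x - f (x + z)) ^ 2 / ‖z‖ ^ ((d : ℝ) + α)) ?_
    refine Measurable.stronglyMeasurable ?_
    have := hf.measurable
    unfold Function.uncurry
    fun_prop
  · refine Eventually.of_forall fun x => ?_
    rw [Real.norm_of_nonneg (jumpEnergy_nonneg f x)]
    exact integral_mono (integrableOn_jumpIntegrand hd hα hf hL x)
      ((integrableOn_closedBall_norm_rpow hd hα).const_mul (L ^ 2))
      fun z => jumpIntegrand_le hL x z

theorem sq_setIntegral_le {d : ℕ} {u : Ed d → ℝ} (hu : Continuous u) (ρ : ℝ) :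
    (∫ z in ball (0 : Ed d) ρ, u z) ^ 2 ≤
      (volume : Measure (Ed d)).real (ball 0 ρ) * ∫ z in ball (0 : Ed d) ρ, u z ^ 2 := by
  set m := (volume : Measure (Ed d)).real (ball 0 ρ) with hm
  have hint : ∀ g : Ed d → ℝ, Continuous g → IntegrableOn g (ball 0 ρ) := fun g hg =>
    (hg.continuousOn.integrableOn_compact (isCompact_closedBall 0 ρ)).mono_set ball_subset_closedBall
  rcases (measureReal_nonneg (μ := (volume : Measure (Ed d))) (s := ball 0 ρ)).eq_or_lt with h0 | hpos
  · have hz : (volume : Measure (Ed d)) (ball 0 ρ) = 0 :=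
      (measureReal_eq_zero_iff measure_ball_lt_top.ne).1 h0.symm
    simp [Measure.restrict_eq_zero.2 hz]
  rw [← hm] at hpos
  set I := ∫ z in ball (0 : Ed d) ρ, u z
  have h : 0 ≤ ∫ z in ball (0 : Ed d) ρ, (m * u z - I) ^ 2 := integral_nonneg fun z => sq_nonneg _
  have e : ∫ z in ball (0 : Ed d) ρ, (m * u z - I) ^ 2 =
      m ^ 2 * (∫ z in ball (0 : Ed d) ρ, u z ^ 2) - 2 * m * I * I + m * I ^ 2 := by
    have : ∀ z, (m * u z - I) ^ 2 = m ^ 2 * u z ^ 2 - 2 * m * I * u z + I ^ 2 := fun z => by ring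
    simp_rw [this]
    rw [integral_add, integral_sub, integral_const_mul, integral_const_mul, setIntegral_const,
      smul_eq_mul]
    · exact hint _ (by fun_prop)
    · exact hint _ (by fun_prop)
    · exact hint _ (by fun_prop)
    · exact hint _ (by fun_prop)
  rw [e] at h
  have : 0 ≤ m * (m * (∫ z in ball (0 : Ed d) ρ, u z ^ 2) - I ^ 2) := by linarith
  linarith [nonneg_of_mul_nonneg_right this hpos]

theorem setIntegral_sq_sub_le_jumpEnergy {d : ℕ} (hd : 1 ≤ d) {α L : ℝ} (hα : 0 < α ∧ α < 2)
    {f : Ed d → ℝ} (hf : Continuous f) (hL : ∀ x y, |f x - f y| ≤ L * ‖x - y‖)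
    {ρ : ℝ} (hρ : 0 < ρ) (hρ1 : ρ ≤ 1) (x : Ed d) :
    ∫ z in ball (0 : Ed d) ρ, (f x - f (x + z)) ^ 2 ≤ ρ ^ ((d : ℝ) + α) * jumpEnergy d α f x := by
  have hsub : ball (0 : Ed d) ρ ⊆ closedBall 0 1 :=
    ball_subset_closedBall.trans (closedBall_subset_closedBall hρ1)
  have hi := integrableOn_jumpIntegrand hd hα.2 hf hL x
  calc ∫ z in ball (0 : Ed d) ρ, (f x - f (x + z)) ^ 2
      ≤ ∫ z in ball (0 : Ed d) ρ,
          ρ ^ ((d : ℝ) + α) * ((f x - f (x + z)) ^ 2 / ‖z‖ ^ ((d : ℝ) + α)) := by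
        refine setIntegral_mono_on ?_ ((hi.mono_set hsub).const_mul _) measurableSet_ball ?_
        · exact ((by fun_prop : Continuous fun z => (f x - f (x + z)) ^ 2).continuousOn
            |>.integrableOn_compact (isCompact_closedBall 0 ρ)).mono_set ball_subset_closedBall
        · intro z hz
          rcases eq_or_ne z 0 with rfl | hz0
          · simp
          have hz' : 0 < ‖z‖ := norm_pos_iff.2 hz0
          rw [mul_div_left_comm]
          refine le_mul_of_one_le_right (sq_nonneg _) ?_
          rw [one_le_div (by positivity)]
          exact Real.rpow_le_rpow hz'.le (mem_ball_zero_iff.1 hz).le (by have := hα.1; positivity)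
    _ = ρ ^ ((d : ℝ) + α) * ∫ z in ball (0 : Ed d) ρ,
          (f x - f (x + z)) ^ 2 / ‖z‖ ^ ((d : ℝ) + α) := integral_const_mul _ _
    _ ≤ ρ ^ ((d : ℝ) + α) * jumpEnergy d α f x := by
        gcongr
        exact setIntegral_mono_set hi
          (Eventually.of_forall fun z => jumpIntegrand_nonneg f x z) hsub.eventuallyLE

theorem setIntegral_abs_comp_add_le {d : ℕ} {f : Ed d → ℝ} (hf : Continuous f) {r ρ : ℝ}
    {x : Ed d} (h : ‖x‖ + ρ ≤ r) :
    ∫ z in ball (0 : Ed d) ρ, |f (x + z)| ≤ ∫ y in ball (0 : Ed d) r, |f y| := by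
  have e := setIntegral_comp_add_left (fun y => |f y|) x (ball x ρ)
  have : (fun z => x + z) ⁻¹' ball x ρ = ball (0 : Ed d) ρ := by ext z; simp
  rw [this] at e
  rw [e]
  refine setIntegral_mono_set ?_ (Eventually.of_forall fun z => abs_nonneg _)
    (ball_subset_ball' (by simpa [add_comm] using h)).eventuallyLE
  exact ((by fun_prop : Continuous fun y => |f y|).continuousOn.integrableOn_compact
    (isCompact_closedBall 0 r)).mono_set ball_subset_closedBall

theorem setIntegral_setIntegral_abs_comp_add_le {d : ℕ} {f : Ed d → ℝ} (hf : Continuous f)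
    {r ρ : ℝ} :
    ∫ x in ball (0 : Ed d) r, ∫ z in ball (0 : Ed d) ρ, |f (x + z)| ≤
      (volume : Measure (Ed d)).real (ball 0 ρ) * ∫ y in ball (0 : Ed d) (r + ρ), |f y| := by
  have hi : Integrable (Function.uncurry fun x z : Ed d => |f (x + z)|)
      ((volume.restrict (ball (0 : Ed d) r)).prod (volume.restrict (ball (0 : Ed d) ρ))) := by
    rw [Measure.prod_restrict]
    refine IntegrableOn.mono_set (t := closedBall (0 : Ed d) r ×ˢ closedBall (0 : Ed d) ρ) ?_
      (prod_mono ball_subset_closedBall ball_subset_closedBall)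
    refine ContinuousOn.integrableOn_compact
      ((isCompact_closedBall 0 r).prod (isCompact_closedBall 0 ρ)) ?_
    unfold Function.uncurry
    fun_prop
  rw [integral_integral_swap hi]
  rw [← smul_eq_mul, ← setIntegral_const]
  refine setIntegral_mono_on hi.integral_prod_right (integrableOn_const measure_ball_lt_top.ne)
    measurableSet_ball ?_
  intro z hz
  simp_rw [add_comm _ z]
  refine setIntegral_abs_comp_add_le hf ?_
  have : ‖z‖ < ρ := by simpa using hz
  linarith

theorem sq_le_jumpEnergy_add {d : ℕ} (hd : 1 ≤ d) {α L : ℝ} (hα : 0 < α ∧ α < 2)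
    {f : Ed d → ℝ} (hf : Continuous f) (hL : ∀ x y, |f x - f y| ≤ L * ‖x - y‖)
    {ρ : ℝ} (hρ : 0 < ρ) (hρ1 : ρ ≤ 1) {r : ℝ} {x : Ed d} (hx : ‖x‖ ≤ r) :
    f x ^ 2 ≤ 2 * (ρ ^ α / (volume : Measure (Ed d)).real (ball 0 1)) * jumpEnergy d α f x +
      2 * (∫ y in ball (0 : Ed d) (r + 1), |f y|) /
        (volume : Measure (Ed d)).real (ball 0 ρ) ^ 2 *
        ∫ z in ball (0 : Ed d) ρ, |f (x + z)| := by
  set m := (volume : Measure (Ed d)).real (ball 0 ρ) with hm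
  set v := (volume : Measure (Ed d)).real (ball 0 1) with hv
  have hv0 : 0 < v := ENNReal.toReal_pos (measure_ball_pos _ _ one_pos).ne' measure_ball_lt_top.ne
  have hmv : m = ρ ^ (d : ℝ) * v := by
    rw [hm, hv, measureReal_def, Measure.addHaar_ball_of_pos _ _ hρ]
    simp [measureReal_def, ENNReal.toReal_ofReal (pow_nonneg hρ.le d)]
  have hm0 : 0 < m := ENNReal.toReal_pos (measure_ball_pos _ _ hρ).ne' measure_ball_lt_top.ne
  set N := ∫ y in ball (0 : Ed d) (r + 1), |f y|
  set B := ∫ z in ball (0 : Ed d) ρ, |f (x + z)|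
  set J := jumpEnergy d α f x
  have hBN : B ≤ N := setIntegral_abs_comp_add_le hf (by linarith)
  have hB0 : 0 ≤ B := integral_nonneg fun z => abs_nonneg _
  have hint : ∀ g : Ed d → ℝ, Continuous g → IntegrableOn g (ball 0 ρ) := fun g hg =>
    (hg.continuousOn.integrableOn_compact (isCompact_closedBall 0 ρ)).mono_set ball_subset_closedBall
  set D := ∫ z in ball (0 : Ed d) ρ, (f x - f (x + z))
  set A := ∫ z in ball (0 : Ed d) ρ, f (x + z)
  have hD : D = m * f x - A := by
    simp only [D]
    rw [integral_sub (hint _ (by fun_prop)) (hint _ (by fun_prop)), setIntegral_const, smul_eq_mul]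
  have hD2 : D ^ 2 ≤ m * (ρ ^ ((d : ℝ) + α) * J) :=
    (sq_setIntegral_le (by fun_prop) ρ).trans
      (by gcongr; exact setIntegral_sq_sub_le_jumpEnergy hd hα hf hL hρ hρ1 x)
  have hA : |A| ≤ B := abs_integral_le_integral_abs
  have hA2 : A ^ 2 ≤ N * B := by
    rw [← sq_abs]; nlinarith [abs_nonneg A]
  have key : m ^ 2 * f x ^ 2 ≤ 2 * (m * (ρ ^ ((d : ℝ) + α) * J)) + 2 * (N * B) := by
    have : m * f x = D + A := by linarith
    rw [← mul_pow, this]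
    linarith [sq_nonneg (D - A)]
  have : f x ^ 2 ≤ (2 * (m * (ρ ^ ((d : ℝ) + α) * J)) + 2 * (N * B)) / m ^ 2 := by
    rw [le_div_iff₀ (by positivity)]; linarith
  refine this.trans_eq ?_
  rw [add_div]
  congr 1
  · rw [Real.rpow_add hρ, hmv]; field_simp
  · field_simp

theorem setIntegral_muV {d : ℕ} {V : Ed d → ℝ} (hV : Measurable V) (g : Ed d → ℝ)
    {S : Set (Ed d)} (hS : MeasurableSet S) :
    ∫ x in S, g x ∂(muV d V) =
      ∫ x in S, (∫ y, Real.exp (-V y))⁻¹ * Real.exp (-V x) * g x := by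
  have h0 : 0 ≤ (∫ y, Real.exp (-V y))⁻¹ := inv_nonneg.2 (integral_nonneg fun y => (exp_pos _).le)
  unfold muV
  rw [setIntegral_withDensity_eq_setIntegral_toReal_smul₀ (by fun_prop)
    (Eventually.of_forall fun x => ENNReal.ofReal_lt_top) _ hS]
  refine integral_congr_ae (Eventually.of_forall fun x => ?_)
  simp only [smul_eq_mul]
  rw [ENNReal.toReal_ofReal (mul_nonneg h0 (exp_pos _).le)]

theorem isFiniteMeasure_muV {d : ℕ} {V : Ed d → ℝ}
    (hV : Integrable (fun x => Real.exp (-V x))) : IsFiniteMeasure (muV d V) :=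
  isFiniteMeasure_withDensity_ofReal (hV.const_mul _).2

theorem LocallyBounded.kfun_pos {d : ℕ} {V : Ed d → ℝ} (hV : LocallyBounded d V) {r : ℝ}
    (hr : 0 ≤ r) : 0 < kfun d V r := by
  obtain ⟨M, hM⟩ := hV (r + 1)
  refine (exp_pos (-M)).trans_le (le_csInf ⟨_, 0, by simp; linarith, rfl⟩ ?_)
  rintro _ ⟨x, hx, rfl⟩
  exact exp_le_exp.2 (neg_le_neg ((le_abs_self _).trans (hM x hx)))

theorem kfun_le {d : ℕ} (V : Ed d → ℝ) {r : ℝ} {x : Ed d} (hx : ‖x‖ ≤ r + 1) :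
    kfun d V r ≤ Real.exp (-V x) :=
  csInf_le ⟨0, by rintro _ ⟨x, -, rfl⟩; exact (exp_pos _).le⟩ ⟨x, hx, rfl⟩

theorem LocallyBounded.le_Kfun {d : ℕ} {V : Ed d → ℝ} (hV : LocallyBounded d V) {r : ℝ}
    {x : Ed d} (hx : ‖x‖ ≤ r) : Real.exp (-V x) ≤ Kfun d V r := by
  obtain ⟨M, hM⟩ := hV r
  refine le_csSup ⟨Real.exp M, ?_⟩ ⟨x, hx, rfl⟩
  rintro _ ⟨y, hy, rfl⟩
  exact exp_le_exp.2 (by linarith [neg_le_abs (V y), hM y hy])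

theorem LocallyBounded.kfun_le_Kfun {d : ℕ} {V : Ed d → ℝ} (hV : LocallyBounded d V) {r : ℝ}
    (hr : 0 ≤ r) : kfun d V r ≤ Kfun d V r :=
  (kfun_le V (x := 0) (by simp; linarith)).trans (hV.le_Kfun (by simpa using hr))

theorem integrable_density_mul {d : ℕ} {V : Ed d → ℝ}
    (hVint : Integrable (fun x => Real.exp (-V x))) (c : ℝ) {g : Ed d → ℝ} (hg : Measurable g)
    {C : ℝ} (hC : ∀ x, |g x| ≤ C) : Integrable fun x => c * Real.exp (-V x) * g x :=
  (hVint.const_mul c).mul_bdd hg.aestronglyMeasurable (Eventually.of_forall hC)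

theorem integrableOn_ball_of_bounded {d : ℕ} {g : Ed d → ℝ} (hg : Measurable g) {C : ℝ}
    (hC : ∀ x, |g x| ≤ C) (r : ℝ) : IntegrableOn g (ball 0 r) :=
  Measure.integrableOn_of_bounded measure_ball_lt_top.ne hg.aestronglyMeasurable
    (Eventually.of_forall hC)

theorem kfun_mul_setIntegral_le {d : ℕ} {V : Ed d → ℝ} (hVmeas : Measurable V)
    (hVint : Integrable (fun x => Real.exp (-V x))) {g : Ed d → ℝ} (hg : Measurable g)
    (hg0 : ∀ x, 0 ≤ g x) {C : ℝ} (hC : ∀ x, |g x| ≤ C) (r : ℝ) :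
    (∫ y, Real.exp (-V y))⁻¹ * kfun d V r * ∫ x in ball (0 : Ed d) (r + 1), g x ≤
      ∫ x in ball (0 : Ed d) (r + 1), g x ∂(muV d V) := by
  have h0 : 0 ≤ (∫ y, Real.exp (-V y))⁻¹ := inv_nonneg.2 (integral_nonneg fun y => (exp_pos _).le)
  rw [setIntegral_muV hVmeas g measurableSet_ball, ← integral_const_mul]
  refine setIntegral_mono_on ((integrableOn_ball_of_bounded hg hC _).const_mul _)
    (integrable_density_mul hVint _ hg hC).integrableOn measurableSet_ball fun x hx => ?_
  have := hg0 x
  gcongr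
  exact kfun_le V (mem_ball_zero_iff.1 hx).le

theorem setIntegral_muV_le_Kfun_mul {d : ℕ} {V : Ed d → ℝ} (hVmeas : Measurable V)
    (hVloc : LocallyBounded d V)
    (hVint : Integrable (fun x => Real.exp (-V x))) {g : Ed d → ℝ} (hg : Measurable g)
    (hg0 : ∀ x, 0 ≤ g x) {C : ℝ} (hC : ∀ x, |g x| ≤ C) (r : ℝ) :
    ∫ x in ball (0 : Ed d) r, g x ∂(muV d V) ≤
      (∫ y, Real.exp (-V y))⁻¹ * Kfun d V r * ∫ x in ball (0 : Ed d) r, g x := by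
  have h0 : 0 ≤ (∫ y, Real.exp (-V y))⁻¹ := inv_nonneg.2 (integral_nonneg fun y => (exp_pos _).le)
  rw [setIntegral_muV hVmeas g measurableSet_ball, ← integral_const_mul]
  refine setIntegral_mono_on (integrable_density_mul hVint _ hg hC).integrableOn
    ((integrableOn_ball_of_bounded hg hC _).const_mul _) measurableSet_ball fun x hx => ?_
  have := hg0 x
  gcongr
  exact hVloc.le_Kfun (mem_ball_zero_iff.1 hx).le

theorem CbSmooth.exists_lipschitz {d : ℕ} {f : Ed d → ℝ} (hf : CbSmooth d f) :
    ∃ L, ∀ x y, |f x - f y| ≤ L * ‖x - y‖ := by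
  obtain ⟨L, hL⟩ := hf.2 1
  refine ⟨L, fun x y => ?_⟩
  refine Convex.norm_image_sub_le_of_norm_fderiv_le (𝕜 := ℝ) (s := univ)
    (fun z _ => (hf.1.differentiable (by simp)).differentiableAt) (fun z _ => ?_)
    convex_univ (mem_univ y) (mem_univ x)
  rw [← norm_iteratedFDeriv_one]
  exact hL z

theorem CbSmooth.exists_bound {d : ℕ} {f : Ed d → ℝ} (hf : CbSmooth d f) :
    ∃ C, ∀ x, |f x| ≤ C := by
  obtain ⟨C, hC⟩ := hf.2 0
  exact ⟨C, fun x => by simpa using hC x⟩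

/-- The local super Poincaré inequality at a fixed averaging radius `ρ`. -/
theorem setIntegral_sq_muV_le {d : ℕ} (hd : 1 ≤ d) {α : ℝ} (hα : 0 < α ∧ α < 2)
    {V : Ed d → ℝ} (hVmeas : Measurable V) (hVloc : LocallyBounded d V)
    (hVint : Integrable (fun x => Real.exp (-V x))) {f : Ed d → ℝ} (hf : CbSmooth d f)
    {r : ℝ} (hr : 1 < r) {ρ : ℝ} (hρ : 0 < ρ) (hρ1 : ρ ≤ 1) :
    ∫ x in ball (0 : Ed d) r, (f x) ^ 2 ∂(muV d V) ≤
      4 * (ρ ^ α / (volume : Measure (Ed d)).real (ball 0 1)) * formE d α V f +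
      2 * (∫ y, Real.exp (-V y)) / (volume : Measure (Ed d)).real (ball 0 ρ) *
        (Kfun d V r / kfun d V r ^ 2) *
        (∫ x in ball (0 : Ed d) (r+1), |f x| ∂(muV d V)) ^ 2 := by
  obtain ⟨L, hL⟩ := hf.exists_lipschitz
  obtain ⟨C, hC⟩ := hf.exists_bound
  have hfc : Continuous f := hf.1.continuous
  have hfm := hfc.measurable
  have := isFiniteMeasure_muV hVint
  set v := (volume : Measure (Ed d)).real (ball 0 1)
  set m := (volume : Measure (Ed d)).real (ball 0 ρ)
  have hv0 : 0 < v := ENNReal.toReal_pos (measure_ball_pos _ _ one_pos).ne' measure_ball_lt_top.ne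
  have hm0 : 0 < m := ENNReal.toReal_pos (measure_ball_pos _ _ hρ).ne' measure_ball_lt_top.ne
  have hZ : 0 < ∫ y, Real.exp (-V y) := integral_exp_pos hVint
  have hk : 0 < kfun d V r := hVloc.kfun_pos (by linarith)
  have hK : 0 < Kfun d V r := hk.trans_le (hVloc.kfun_le_Kfun (by linarith))
  set B : Ed d → ℝ := fun x => ∫ z in ball (0 : Ed d) ρ, |f (x + z)| with hB
  have hB0 : ∀ x, 0 ≤ B x := fun x => integral_nonneg fun z => abs_nonneg _
  have hBm : Measurable B := by
    refine (StronglyMeasurable.integral_prod_right (f := fun x z => |f (x + z)|) ?_).measurable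
    refine Measurable.stronglyMeasurable ?_
    unfold Function.uncurry
    fun_prop
  have hBb : ∀ x, |B x| ≤ C * m := fun x => by
    rw [← Real.norm_eq_abs]
    exact norm_setIntegral_le_of_norm_le_const measure_ball_lt_top fun z _ => by simpa using hC _
  have hJ := integrable_jumpEnergy hd hα.2 hfc hL (muV d V)
  set N := ∫ y in ball (0 : Ed d) (r + 1), |f y| with hN
  have hN0 : 0 ≤ N := integral_nonneg fun z => abs_nonneg _
  set I := ∫ x in ball (0 : Ed d) (r+1), |f x| ∂(muV d V) with hI
  have hNI : N ≤ (∫ y, Real.exp (-V y)) / kfun d V r * I := by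
    have h := kfun_mul_setIntegral_le hVmeas hVint (g := fun x => |f x|) (by fun_prop)
      (fun x => abs_nonneg _) (fun x => by simpa using hC x) r
    rw [inv_mul_eq_div, div_mul_eq_mul_div, div_le_iff₀ hZ] at h
    rw [div_mul_eq_mul_div, le_div_iff₀ hk]
    linarith
  have hBi : Integrable B (muV d V) :=
    Integrable.of_bound hBm.aestronglyMeasurable (C * m) (Eventually.of_forall hBb)
  have hBint : ∫ x in ball (0 : Ed d) r, B x ∂(muV d V) ≤
      (∫ y, Real.exp (-V y))⁻¹ * Kfun d V r * (m * N) := by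
    refine (setIntegral_muV_le_Kfun_mul hVmeas hVloc hVint hBm hB0 hBb r).trans ?_
    gcongr
    refine (setIntegral_setIntegral_abs_comp_add_le hfc).trans ?_
    refine mul_le_mul_of_nonneg_left (setIntegral_mono_set ?_
      (Eventually.of_forall fun _ => abs_nonneg _)
      (ball_subset_ball (by linarith)).eventuallyLE) hm0.le
    exact integrableOn_ball_of_bounded (by fun_prop) (fun x => by simpa using hC x) _
  have hJint : ∫ x in ball (0 : Ed d) r, jumpEnergy d α f x ∂(muV d V) ≤ 2 * formE d α V f := by
    rw [formE_eq_jumpEnergy]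
    refine (setIntegral_le_integral hJ (Eventually.of_forall fun x => jumpEnergy_nonneg f x)).trans ?_
    linarith
  set a := 2 * (ρ ^ α / v) with ha
  set b := 2 * N / m ^ 2 with hb
  have ha0 : 0 ≤ a := by positivity
  have hb0 : 0 ≤ b := by positivity
  calc ∫ x in ball (0 : Ed d) r, (f x) ^ 2 ∂(muV d V)
      ≤ ∫ x in ball (0 : Ed d) r, (a * jumpEnergy d α f x + b * B x) ∂(muV d V) := by
        refine setIntegral_mono_on ?_ ((hJ.const_mul a).add (hBi.const_mul b)).integrableOn
          measurableSet_ball fun x hx =>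
            sq_le_jumpEnergy_add hd hα hfc hL hρ hρ1 (mem_ball_zero_iff.1 hx).le
        refine (Integrable.of_bound (by fun_prop) (C ^ 2)
          (Eventually.of_forall fun x => ?_)).integrableOn
        rw [norm_pow, Real.norm_eq_abs]
        exact pow_le_pow_left₀ (abs_nonneg _) (hC x) 2
    _ = a * (∫ x in ball (0 : Ed d) r, jumpEnergy d α f x ∂(muV d V)) +
          b * ∫ x in ball (0 : Ed d) r, B x ∂(muV d V) := by
        rw [integral_add (hJ.const_mul a).integrableOn (hBi.const_mul b).integrableOn,
          integral_const_mul, integral_const_mul]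
    _ ≤ a * (2 * formE d α V f) + b * ((∫ y, Real.exp (-V y))⁻¹ * Kfun d V r * (m * N)) := by
        gcongr
    _ = 4 * (ρ ^ α / v) * formE d α V f +
          2 * (∫ y, Real.exp (-V y))⁻¹ / m * Kfun d V r * N ^ 2 := by
        rw [ha, hb]; field_simp; ring
    _ ≤ 4 * (ρ ^ α / v) * formE d α V f + 2 * (∫ y, Real.exp (-V y))⁻¹ / m * Kfun d V r *
          ((∫ y, Real.exp (-V y)) / kfun d V r * I) ^ 2 := by
        gcongr
    _ = _ := by field_simp

/-- The choice of the averaging radius for a given `s`. -/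
theorem exists_radius {d : ℕ} {α v s : ℝ} (hα : 0 < α) (hv : 0 < v) (hs : 0 < s) :
    ∃ ρ : ℝ, 0 < ρ ∧ ρ ≤ 1 ∧ 4 * (ρ ^ α / v) ≤ s ∧
      (ρ ^ d)⁻¹ ≤ (1 + (v / 4) ^ (-((d : ℝ) / α))) * (1 + s ^ (-((d : ℝ) / α))) := by
  set t := v / 4 * s with ht
  have ht0 : 0 < t := by positivity
  have hx : 0 ≤ (v / 4) ^ (-((d : ℝ) / α)) := by positivity
  have hy : 0 ≤ s ^ (-((d : ℝ) / α)) := by positivity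
  rcases le_total t 1 with h | h
  · refine ⟨t ^ α⁻¹, by positivity, Real.rpow_le_one ht0.le h (by positivity), ?_, ?_⟩
    · rw [Real.rpow_inv_rpow ht0.le hα.ne', ht]
      apply le_of_eq; field_simp
    · have e : ((t ^ α⁻¹) ^ d)⁻¹ = (v / 4) ^ (-((d : ℝ) / α)) * s ^ (-((d : ℝ) / α)) := by
        rw [← Real.mul_rpow (by positivity) hs.le, ← ht, Real.rpow_neg ht0.le, ← Real.rpow_natCast,
          ← Real.rpow_mul ht0.le, inv_mul_eq_div]
      rw [e]
      nlinarith
  · refine ⟨1, one_pos, le_rfl, ?_, ?_⟩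
    · rw [Real.one_rpow, mul_one_div, div_le_iff₀ hv]; linarith
    · simp only [one_pow, inv_one]
      nlinarith [mul_nonneg hx hy]

/-- local super Poincaré inequality for `𝓔_{α,V}` with rate
`β_r(s) = C₂ r^{d+d²/α} K(r)^{1+d/α} k(r)^{-(2+d/α)} (1+s^{-d/α})`. -/
theorem local_super_poincare_formE
    (d : ℕ) (hd : 1 ≤ d) (α : ℝ) (hα : 0 < α ∧ α < 2)
    (V : Ed d → ℝ) (hVmeas : Measurable V) (hVloc : LocallyBounded d V)
    (hVint : Integrable (fun x => Real.exp (-V x))) :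
    ∃ C₂ : ℝ, 0 < C₂ ∧ ∀ r : ℝ, 1 < r → ∀ s : ℝ, 0 < s → ∀ f : Ed d → ℝ, CbSmooth d f →
      ∫ x in ball (0 : Ed d) r, (f x) ^ 2 ∂(muV d V) ≤
        s * formE d α V f +
        (C₂ * r ^ ((d:ℝ) + (d:ℝ)^2/α) * Kfun d V r ^ (1 + (d:ℝ)/α) *
          kfun d V r ^ (-(2 + (d:ℝ)/α)) * (1 + s ^ (-((d:ℝ)/α)))) *
        (∫ x in ball (0 : Ed d) (r+1), |f x| ∂(muV d V)) ^ 2 := by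
  set v := (volume : Measure (Ed d)).real (ball 0 1) with hv
  have hv0 : 0 < v := ENNReal.toReal_pos (measure_ball_pos _ _ one_pos).ne' measure_ball_lt_top.ne
  have hZ : 0 < ∫ y, Real.exp (-V y) := integral_exp_pos hVint
  have hα0 := hα.1
  refine ⟨2 * (∫ y, Real.exp (-V y)) / v * (1 + (v / 4) ^ (-((d : ℝ) / α))), by positivity,
    fun r hr s hs f hf => ?_⟩
  obtain ⟨ρ, hρ, hρ1, hρs, hρd⟩ := exists_radius (d := d) hα0 hv0 hs
  refine (setIntegral_sq_muV_le hd hα hVmeas hVloc hVint hf hr hρ hρ1).trans ?_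
  have hE : 0 ≤ formE d α V f := by
    rw [formE_eq_jumpEnergy]
    exact mul_nonneg (by norm_num) (integral_nonneg fun x => jumpEnergy_nonneg f x)
  have hk : 0 < kfun d V r := hVloc.kfun_pos (by linarith)
  have hkK := hVloc.kfun_le_Kfun (r := r) (by linarith)
  have hK : 0 < Kfun d V r := hk.trans_le hkK
  have hm : (volume : Measure (Ed d)).real (ball 0 ρ) = ρ ^ d * v := by
    rw [hv, measureReal_def, Measure.addHaar_ball_of_pos _ _ hρ]
    simp [measureReal_def, ENNReal.toReal_ofReal (pow_nonneg hρ.le d)]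
  have hKk : Kfun d V r / kfun d V r ^ 2 ≤
      r ^ ((d:ℝ) + (d:ℝ)^2/α) * (Kfun d V r ^ (1 + (d:ℝ)/α) * kfun d V r ^ (-(2 + (d:ℝ)/α))) := by
    have e : Kfun d V r ^ (1 + (d:ℝ)/α) * kfun d V r ^ (-(2 + (d:ℝ)/α)) =
        Kfun d V r / kfun d V r ^ 2 * (Kfun d V r / kfun d V r) ^ ((d : ℝ) / α) := by
      rw [Real.rpow_add hK, Real.rpow_neg hk.le, Real.rpow_add hk, Real.div_rpow hK.le hk.le,
        Real.rpow_one, Real.rpow_two]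
      field_simp
    have h1 : 1 ≤ (Kfun d V r / kfun d V r) ^ ((d : ℝ) / α) :=
      Real.one_le_rpow ((one_le_div hk).2 hkK) (by positivity)
    have h2 : 1 ≤ r ^ ((d:ℝ) + (d:ℝ)^2/α) := Real.one_le_rpow hr.le (by positivity)
    rw [e]
    have h3 : 0 ≤ Kfun d V r / kfun d V r ^ 2 := by positivity
    exact (le_mul_of_one_le_right h3 h1).trans
      (le_mul_of_one_le_left (mul_nonneg h3 (zero_le_one.trans h1)) h2)
  rw [← hv]
  refine add_le_add (mul_le_mul_of_nonneg_right hρs hE)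
    (mul_le_mul_of_nonneg_right ?_ (sq_nonneg _))
  calc 2 * (∫ y, Real.exp (-V y)) / (volume : Measure (Ed d)).real (ball 0 ρ) *
        (Kfun d V r / kfun d V r ^ 2)
      = 2 * (∫ y, Real.exp (-V y)) / v * (ρ ^ d)⁻¹ * (Kfun d V r / kfun d V r ^ 2) := by
        rw [hm]; field_simp
    _ ≤ 2 * (∫ y, Real.exp (-V y)) / v *
          ((1 + (v / 4) ^ (-((d : ℝ) / α))) * (1 + s ^ (-((d : ℝ) / α)))) *
          (r ^ ((d:ℝ) + (d:ℝ)^2/α) *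
            (Kfun d V r ^ (1 + (d:ℝ)/α) * kfun d V r ^ (-(2 + (d:ℝ)/α)))) := by
        gcongr
    _ = _ := by ring
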